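/- arXiv:2408.02633 — 3 statements merged into one kernel-verified Lean document; each statement's English description precedes it below -/
import Mathlib

section
/- In the q-shuffle algebra V on letters x, y, for every natural number n, q·((xyy(xxyy)^n) ⋆ x) − q^{-1}·(x ⋆ (xyy(xxyy)^n)) = (q − q^{-3})·(xyy(xxyy)^n x − (xxyy)^{n+1}), where all words are concatenation words. -/
noncomputable section

/-- The letter `x`. -/
def bX : Bool := false
/-- The letter `y`. -/
def bY : Bool := true

/-- The bilinear pairing on letters: `⟨x,x⟩ = ⟨y,y⟩ = 2`, `⟨x,y⟩ = ⟨y,x⟩ = -2`. -/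
def qbr (a b : Bool) : ℤ := if a = b then 2 else -2

/-- The sum `⟨a, w₁⟩ + ⋯ + ⟨a, wₙ⟩` for a letter `a` and a word `w`. -/
def qE (a : Bool) (w : List Bool) : ℤ := (w.map (qbr a)).sum

/-- Linear map on the free algebra (words-indexed finsupps) given by prepending a letter. -/
def qcons (F : Type*) [Field F] (a : Bool) :
    (List Bool →₀ F) →ₗ[F] (List Bool →₀ F) :=
  Finsupp.lmapDomain F F (List.cons a)

/-- The q-shuffle product of two words, as an element of the free algebra `List Bool →₀ F`.
Defined by the recursion `u ⋆ v = u₁((u₂⋯u_r) ⋆ v) + q^{⟨v₁,u₁⟩+⋯+⟨v₁,u_r⟩} v₁(u ⋆ (v₂⋯v_s))`. -/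
def qsh {F : Type*} [Field F] (q : F) : List Bool → List Bool → (List Bool →₀ F)
  | [], v => Finsupp.single v 1
  | a :: u, [] => Finsupp.single (a :: u) 1
  | a :: u, b :: v =>
      qcons F a (qsh q u (b :: v)) +
        (q ^ (qbr b a + qE b u)) • qcons F b (qsh q (a :: u) v)
  termination_by u v => u.length + v.length
  decreasing_by all_goals (simp only [List.length_cons]; omega)

/-- Concatenation power of a word. -/
def wpow (w : List Bool) : ℕ → List Bool
  | 0 => []
  | n + 1 => w ++ wpow w n

def wXXYY : List Bool := [bX, bX, bY, bY]
def wYYXX : List Bool := [bY, bY, bX, bX]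
def wXY : List Bool := [bX, bY]
def wYX : List Bool := [bY, bX]

theorem qE_pow (n : ℕ) : qE bX (wpow wXXYY n) = 0 := by
  induction n with
  | zero => simp [qE, wpow]
  | succ k ih =>
    simp only [qE] at ih
    simp [qE, wpow, wXXYY, qbr, bX, bY] at ih ⊢
    omega

theorem qE_cons (a b : Bool) (w : List Bool) : qE a (b :: w) = qbr a b + qE a w := by
  simp [qE]

theorem qsh_right {F : Type*} [Field F] (q : F) (a b : Bool) (u : List Bool) :
    qsh q (a :: u) [b] = qcons F a (qsh q u [b]) +
      (q ^ (qbr b a + qE b u)) • Finsupp.single (b :: a :: u) 1 := by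
  rw [qsh, qsh]
  simp [qcons]

theorem qsh_left {F : Type*} [Field F] (q : F) (a b : Bool) (v : List Bool) :
    qsh q [a] (b :: v) = Finsupp.single (a :: b :: v) 1 +
      (q ^ (qbr b a)) • qcons F b (qsh q [a] v) := by
  rw [qsh, qsh]
  simp [qcons, qE]

theorem qcons_single {F : Type*} [Field F] (a : Bool) (w : List Bool) (c : F) :
    qcons F a (Finsupp.single w c) = Finsupp.single (a :: w) c := by
  simp [qcons]

theorem qaux {F : Type*} [Field F] (q : F) (hq : q ≠ 0) (n : ℕ) :
    q • qsh q (wpow wXXYY n) [bX] - q ^ (-3 : ℤ) • qsh q [bX] (wpow wXXYY n)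
      = (q - q ^ (-3 : ℤ)) • Finsupp.single (wpow wXXYY n ++ [bX]) (1 : F) := by
  induction n with
  | zero =>
    simp only [wpow, List.nil_append]
    rw [qsh, qsh]
    module
  | succ k ih =>
    have h := congrArg (fun z => qcons F bX (qcons F bX (qcons F bY (qcons F bY z)))) ih
    have e1 : qbr bX bX = 2 := by decide
    have e2 : qbr bX bY = -2 := by decide
    have e3 : qbr bY bX = -2 := by decide
    simp only [wpow, wXXYY, List.cons_append, List.nil_append] at h ⊢
    have h0 := qE_pow k
    simp only [wXXYY] at h0
    simp only [qsh_right, qsh_left, qE_cons, h0, e1, e2, e3, map_add, map_sub, map_smul,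
      qcons_single] at h ⊢
    rw [← sub_eq_zero] at h ⊢
    rw [← h]
    match_scalars <;> norm_num <;> field_simp <;> ring

/-- `[xyy(xxyy)^n, x]_q = (q − q^{-3})(xyy(xxyy)^n x − (xxyy)^{n+1})` in the q-shuffle algebra. -/
theorem stmt3 {F : Type*} [Field F] [CharZero F] (q : F) (hq : q ≠ 0)
    (hq1 : ∀ m : ℕ, 0 < m → q ^ m ≠ 1) (n : ℕ) :
    q • qsh q ([bX, bY, bY] ++ wpow wXXYY n) [bX]
        - q ^ (-1 : ℤ) • qsh q [bX] ([bX, bY, bY] ++ wpow wXXYY n)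
      = (q - q ^ (-3 : ℤ)) •
          (Finsupp.single ([bX, bY, bY] ++ wpow wXXYY n ++ [bX]) (1 : F)
            - Finsupp.single (wpow wXXYY (n + 1)) (1 : F)) := by
  have ih := qaux q hq n
  have h := congrArg (fun z => qcons F bX (qcons F bY (qcons F bY z))) ih
  have e1 : qbr bX bX = 2 := by decide
  have e2 : qbr bX bY = -2 := by decide
  have e3 : qbr bY bX = -2 := by decide
  simp only [wpow, wXXYY, List.cons_append, List.nil_append] at h ⊢
  have h0 := qE_pow n
  simp only [wXXYY] at h0
  simp only [qsh_right, qsh_left, qE_cons, h0, e1, e2, e3, map_add, map_sub, map_smul,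
    qcons_single] at h ⊢
  rw [← sub_eq_zero] at h ⊢
  rw [← h]
  match_scalars <;> norm_num <;> field_simp <;> ring
end
end

section
/- In the q-shuffle algebra V on letters x, y, define G̃ₖ = (xy)^k (concatenation power, G̃₀ = 1). Then for every natural number n, Σ_{k=0}^{2n+1} (−1)^k G̃ₖ ⋆ G̃_{2n+1−k} = 0. -/
noncomputable section

theorem aux_gs (k : ℕ) : wpow wXY (k+1) = bX :: bY :: wpow wXY k := rfl

theorem aux_eX (k : ℕ) : qE bX (wpow wXY k) = 0 := by
  induction k with
  | zero => rfl
  | succ k ih =>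
    rw [aux_gs]
    simp only [qE, List.map_cons, List.sum_cons] at ih ⊢
    rw [ih]; rfl

theorem aux_eY (k : ℕ) : qE bY (wpow wXY k) = 0 := by
  induction k with
  | zero => rfl
  | succ k ih =>
    rw [aux_gs]
    simp only [qE, List.map_cons, List.sum_cons] at ih ⊢
    rw [ih]; rfl

theorem aux_cons (a b : Bool) (u : List Bool) : qE a (b :: u) = qbr a b + qE a u := by
  simp [qE]

theorem aux_nil {F : Type*} [Field F] (q : F) (v : List Bool) :
    qsh q [] v = Finsupp.single v 1 := by rw [qsh]

theorem aux_nil' {F : Type*} [Field F] (q : F) (v : List Bool) :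
    qsh q v [] = Finsupp.single v 1 := by cases v <;> rw [qsh]

theorem aux_GG {F : Type*} [Field F] (q : F) (k l : ℕ) :
    qsh q (wpow wXY (k+1)) (wpow wXY (l+1)) =
      qcons F bX (qsh q (bY :: wpow wXY k) (wpow wXY (l+1))) +
      qcons F bX (qsh q (wpow wXY (k+1)) (bY :: wpow wXY l)) := by
  rw [aux_gs, aux_gs, qsh, aux_cons, aux_eX]
  simp [qbr, bX, bY]

theorem aux_WG {F : Type*} [Field F] (q : F) (k l : ℕ) :
    qsh q (bY :: wpow wXY k) (wpow wXY (l+1)) =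
      qcons F bY (qsh q (wpow wXY k) (wpow wXY (l+1))) +
      (q ^ (-2 : ℤ)) • qcons F bX (qsh q (bY :: wpow wXY k) (bY :: wpow wXY l)) := by
  rw [aux_gs, qsh, aux_eX]
  simp [qbr, bX, bY]

theorem aux_WG0 {F : Type*} [Field F] (q : F) (k : ℕ) :
    qsh q (bY :: wpow wXY k) (wpow wXY 0) =
      qcons F bY (qsh q (wpow wXY k) (wpow wXY 0)) := by
  simp [wpow, aux_nil', qcons]

theorem aux_GW {F : Type*} [Field F] (q : F) (k l : ℕ) :
    qsh q (wpow wXY (k+1)) (bY :: wpow wXY l) =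
      qcons F bX (qsh q (bY :: wpow wXY k) (bY :: wpow wXY l)) +
      qcons F bY (qsh q (wpow wXY (k+1)) (wpow wXY l)) := by
  rw [aux_gs, qsh, aux_cons, aux_eY]
  simp [qbr, bX, bY]

theorem aux_GW0 {F : Type*} [Field F] (q : F) (k : ℕ) :
    qsh q (wpow wXY 0) (bY :: wpow wXY k) =
      qcons F bY (qsh q (wpow wXY 0) (wpow wXY k)) := by
  simp [wpow, aux_nil, qcons]

theorem aux_WW {F : Type*} [Field F] (q : F) (k l : ℕ) :
    qsh q (bY :: wpow wXY k) (bY :: wpow wXY l) =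
      qcons F bY (qsh q (wpow wXY k) (bY :: wpow wXY l)) +
      (q ^ (2 : ℤ)) • qcons F bY (qsh q (bY :: wpow wXY k) (wpow wXY l)) := by
  rw [qsh, aux_eY]
  simp [qbr]

theorem aux_comm {F : Type*} [Field F] (q : F) (hq : q ≠ 0) (N : ℕ) : ∀ k l : ℕ, k + l = N →
    qsh q (wpow wXY k) (wpow wXY l) = qsh q (wpow wXY l) (wpow wXY k) ∧
    qsh q (bY :: wpow wXY k) (bY :: wpow wXY l) =
      qsh q (bY :: wpow wXY l) (bY :: wpow wXY k) := by
  induction N using Nat.strong_induction_on with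
  | _ N ih =>
  intro k l h
  have hG : qsh q (wpow wXY k) (wpow wXY l) = qsh q (wpow wXY l) (wpow wXY k) := by
    rcases k with _ | k
    · simp [wpow, aux_nil, aux_nil']
    rcases l with _ | l
    · simp [wpow, aux_nil, aux_nil']
    rw [aux_GG, aux_GG, aux_WG, aux_WG, aux_GW, aux_GW,
      (ih (k + (l+1)) (by omega) k (l+1) rfl).1, (ih (k + 1 + l) (by omega) (k+1) l rfl).1,
      (ih (k + l) (by omega) k l rfl).2]
    simp only [map_add]
    abel
  refine ⟨hG, ?_⟩
  have hqq : q ^ (2:ℤ) * q ^ (-2:ℤ) = 1 := by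
    rw [← zpow_add₀ hq]; simp
  rw [aux_WW, aux_WW]
  rcases k with _ | k <;> rcases l with _ | l
  · rfl
  · rw [aux_GW0, aux_WG, aux_GW, aux_WG0, hG, (ih (0 + l) (by omega) 0 l rfl).2]
    simp only [map_add, map_smul, smul_add, smul_smul, hqq, one_smul]
    abel
  · rw [aux_GW0, aux_WG, aux_GW, aux_WG0, hG, (ih (k + 0) (by omega) k 0 rfl).2]
    simp only [map_add, map_smul, smul_add, smul_smul, hqq, one_smul]
    abel
  · rw [aux_GW, aux_WG, aux_GW, aux_WG, hG, (ih (k + (l+1)) (by omega) k (l+1) rfl).2,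
      (ih (k + 1 + l) (by omega) (k+1) l rfl).2]
    simp only [map_add, map_smul, smul_add, smul_smul, hqq, one_smul]
    abel

/-- `Σ_{k=0}^{2n+1} (−1)^k G̃ₖ ⋆ G̃_{2n+1−k} = 0` where `G̃ₖ = (xy)^k`. -/
theorem stmt10 {F : Type*} [Field F] [CharZero F] (q : F) (hq : q ≠ 0)
    (hq1 : ∀ m : ℕ, 0 < m → q ^ m ≠ 1) (n : ℕ) :
    ∑ k ∈ Finset.range (2 * n + 2),
        ((-1 : F) ^ k) • qsh q (wpow wXY k) (wpow wXY (2 * n + 1 - k)) = 0 := by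
  have key : ∀ v : List Bool →₀ F, v = -v → v = 0 := by
    intro v hv
    ext w
    have h := DFunLike.congr_fun hv w
    simp only [Finsupp.coe_neg, Pi.neg_apply] at h
    simpa using self_eq_neg.1 h
  apply key
  conv_lhs => rw [← Finset.sum_range_reflect]
  rw [← Finset.sum_neg_distrib]
  refine Finset.sum_congr rfl fun k hk => ?_
  have hk' : k ≤ 2 * n + 1 := by have := Finset.mem_range.1 hk; omega
  have e1 : 2 * n + 2 - 1 - k = 2 * n + 1 - k := by omega
  have e2 : 2 * n + 1 - (2 * n + 1 - k) = k := by omega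
  rw [e1, e2, (aux_comm q hq _ (2 * n + 1 - k) k rfl).1, ← neg_smul]
  congr 1
  have h1 : (-1 : F) ^ (2 * n + 1 - k) * (-1) ^ k = -1 := by
    rw [← pow_add, Nat.sub_add_cancel hk', pow_succ, pow_mul]; simp
  have h2 : (-1 : F) ^ k * (-1) ^ k = 1 := by
    rw [← mul_pow]; simp
  calc (-1 : F) ^ (2 * n + 1 - k) = (-1 : F) ^ (2 * n + 1 - k) * ((-1 : F) ^ k * (-1) ^ k) := by
        rw [h2, mul_one]
    _ = _ := by rw [← mul_assoc, h1]; ring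
end
end

section
/- In the q-shuffle algebra V on letters x, y, define W_{−k} = (xy)^k x and W_{k+1} = (yx)^k y (concatenation). Then for every natural number n, Σ_{k=0}^{2n} (−1)^k W_{k+1} ⋆ W_{k−2n} = (−1)^n [2]_q^{2n} ( q^{-2} · x(yyxx)^n y + y(xxyy)^n x ), where [2]_q = q + q^{-1} and the words on the right are concatenation words. -/
noncomputable section

namespace QS
open Finset

variable {F : Type*} [Field F]

lemma wY (k : ℕ) : wpow wYX k ++ [bY] = bY :: wpow wXY k := by
  induction k with
  | zero => rfl
  | succ k ih => simp only [wpow, List.append_assoc, ih]; rfl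

lemma wX (k : ℕ) : wpow wXY k ++ [bX] = bX :: wpow wYX k := by
  induction k with
  | zero => rfl
  | succ k ih => simp only [wpow, List.append_assoc, ih]; rfl

lemma qE_a (c : Bool) (k : ℕ) : qE c (wpow wXY k) = 0 := by
  induction k with
  | zero => rfl
  | succ k ih =>
    cases c <;> simp_all [wpow, qE, wXY, qbr, bX, bY]

lemma qsh_nil (q : F) (u : List Bool) : qsh q u [] = Finsupp.single u 1 := by
  cases u <;> simp [qsh]

lemma qsh_nil' (q : F) (u : List Bool) : qsh q [] u = Finsupp.single u 1 := by
  simp [qsh]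

lemma qcons_single (c : Bool) (u : List Bool) (r : F) :
    qcons F c (Finsupp.single u r) = Finsupp.single (c :: u) r := by
  simp [qcons]

def sT (q : F) (N : ℕ) : List Bool →₀ F := ∑ p ∈ antidiagonal N,
  ((-1 : F) ^ p.1) • qsh q (bY :: wpow wXY p.1) (bX :: wpow wYX p.2)
def sU (q : F) (N : ℕ) : List Bool →₀ F := ∑ p ∈ antidiagonal N,
  ((-1 : F) ^ p.1) • qsh q (wpow wXY p.1) (bX :: wpow wYX p.2)
def sV (q : F) (N : ℕ) : List Bool →₀ F := ∑ p ∈ antidiagonal N,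
  ((-1 : F) ^ p.1) • qsh q (bY :: wpow wXY p.1) (wpow wYX p.2)
def sR (q : F) (N : ℕ) : List Bool →₀ F := ∑ p ∈ antidiagonal N,
  ((-1 : F) ^ p.1) • qsh q (wpow wXY p.1) (wpow wYX p.2)

lemma T_eq (q : F) (N : ℕ) :
    sT q N = qcons F bY (sU q N) + q ^ (-2 : ℤ) • qcons F bX (sV q N) := by
  simp only [sT, sU, sV, map_sum, smul_sum, ← sum_add_distrib, map_smul]
  refine sum_congr rfl fun p _ => ?_
  rw [qsh, qE_a, smul_add, smul_comm (q ^ (-2 : ℤ))]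
  rfl

lemma stepU (q : F) (k m : ℕ) : qsh q (wpow wXY k) (bX :: wpow wYX m) =
    (match k with
      | 0 => 0
      | k + 1 => qcons F bX (qsh q (bY :: wpow wXY k) (bX :: wpow wYX m))) +
    qcons F bX (qsh q (wpow wXY k) (wpow wYX m)) := by
  cases k with
  | zero => simp [wpow, qsh_nil', qcons_single]
  | succ k =>
    change qsh q (bX :: bY :: wpow wXY k) _ = _
    rw [qsh]
    have : qbr bX bX + qE bX (bY :: wpow wXY k) = 0 := by
      have := qE_a bX k
      simp only [qE, List.map_cons, List.sum_cons] at *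
      rw [this]; rfl
    rw [this, zpow_zero, one_smul]
    rfl

lemma stepV (q : F) (k m : ℕ) : qsh q (bY :: wpow wXY k) (wpow wYX m) =
    qcons F bY (qsh q (wpow wXY k) (wpow wYX m)) +
    (match m with
      | 0 => 0
      | m + 1 => q ^ (2 : ℤ) • qcons F bY (qsh q (bY :: wpow wXY k) (bX :: wpow wYX m))) := by
  cases m with
  | zero => simp [wpow, qsh_nil, qcons_single]
  | succ k =>
    change qsh q _ (bY :: bX :: wpow wYX k) = _
    rw [qsh, qE_a]
    rfl

lemma stepR (q : F) (k m : ℕ) : k + m ≠ 0 → qsh q (wpow wXY k) (wpow wYX m) =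
    (match k with
      | 0 => 0
      | k + 1 => qcons F bX (qsh q (bY :: wpow wXY k) (wpow wYX m))) +
    (match m with
      | 0 => 0
      | m + 1 => qcons F bY (qsh q (wpow wXY k) (bX :: wpow wYX m))) := by
  intro h
  cases k with
  | zero =>
    cases m with
    | zero => simp at h
    | succ m => simp [wpow, qsh_nil', qcons_single, wYX]
  | succ k =>
    cases m with
    | zero => simp [wpow, qsh_nil, qcons_single, wXY]
    | succ m =>
      change qsh q (bX :: bY :: wpow wXY k) (bY :: bX :: wpow wYX m) = _
      rw [qsh]
      have : qbr bY bX + qE bY (bY :: wpow wXY k) = 0 := by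
        have := qE_a bY k
        simp only [qE, List.map_cons, List.sum_cons] at *
        rw [this]; rfl
      rw [this, zpow_zero, one_smul]
      rfl

lemma U_eq (q : F) (N : ℕ) :
    sU q (N + 1) = qcons F bX (sR q (N + 1) - sT q N) := by
  unfold sU
  simp only [stepU, smul_add, sum_add_distrib]
  rw [Nat.sum_antidiagonal_succ]
  simp only [sR, sT, map_sub, map_sum, map_smul, pow_succ, smul_zero, zero_add, mul_neg, mul_one,
    neg_smul, sum_neg_distrib]
  abel

lemma V_eq (q : F) (N : ℕ) :
    sV q (N + 1) = qcons F bY (sR q (N + 1) + q ^ (2 : ℤ) • sT q N) := by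
  unfold sV
  simp only [stepV, smul_add, sum_add_distrib]
  congr 1
  rw [map_add]
  congr 1
  · simp only [sR, map_sum, map_smul]
  · rw [Nat.sum_antidiagonal_succ']
    simp only [sT, map_sum, map_smul, smul_sum, smul_zero, zero_add, add_zero]
    exact sum_congr rfl fun p _ => smul_comm _ _ _

lemma R_eq (q : F) (N : ℕ) :
    sR q (N + 1) = qcons F bY (sU q N) - qcons F bX (sV q N) := by
  unfold sR
  rw [sum_congr rfl fun p hp => congrArg (fun z => ((-1 : F) ^ p.1) • z)
    (stepR q p.1 p.2 (by rw [HasAntidiagonal.mem_antidiagonal] at hp; omega))]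
  simp only [smul_add, sum_add_distrib]
  rw [Nat.sum_antidiagonal_succ, Nat.sum_antidiagonal_succ']
  simp only [sU, sV, map_sum, map_smul, pow_succ, smul_zero, zero_add, add_zero, mul_neg, mul_one,
    neg_smul, sum_neg_distrib]
  abel

lemma U_rec (q : F) (N : ℕ) : sU q (N + 1) =
    (-(1 + q ^ (-2 : ℤ))) • qcons F bX (qcons F bX (sV q N)) := by
  rw [U_eq, R_eq, T_eq]
  simp only [map_add, map_sub, map_smul]
  module

lemma V_rec (q : F) (hq : q ≠ 0) (N : ℕ) : sV q (N + 1) =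
    (1 + q ^ (2 : ℤ)) • qcons F bY (qcons F bY (sU q N)) := by
  rw [V_eq, R_eq, T_eq]
  have : q ^ (2 : ℤ) * q ^ (-2 : ℤ) = 1 := by rw [← zpow_add₀ hq]; simp
  simp only [map_add, map_sub, map_smul, smul_add, smul_smul, this]
  module

lemma coef (q : F) (hq : q ≠ 0) :
    (1 + q ^ (-2 : ℤ)) * (1 + q ^ (2 : ℤ)) = (q + q⁻¹) ^ 2 := by
  rw [zpow_neg]
  norm_cast
  field_simp
  ring

lemma UV (q : F) (hq : q ≠ 0) (n : ℕ) :
    sU q (2 * n) = ((-1 : F) ^ n * (q + q⁻¹) ^ (2 * n)) •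
      Finsupp.single (wpow wXXYY n ++ [bX]) (1 : F) ∧
    sV q (2 * n) = ((-1 : F) ^ n * (q + q⁻¹) ^ (2 * n)) •
      Finsupp.single (wpow wYYXX n ++ [bY]) (1 : F) := by
  induction n with
  | zero => simp [sU, sV, wpow, qsh_nil, qsh_nil']
  | succ n ih =>
    have h : 2 * (n + 1) = 2 * n + 1 + 1 := by ring
    have hc : (-1 : F) ^ (n + 1) * (q + q⁻¹) ^ (2 * n + 1 + 1) =
        (-(1 + q ^ (-2 : ℤ))) * (1 + q ^ (2 : ℤ)) * ((-1 : F) ^ n * (q + q⁻¹) ^ (2 * n)) := by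
      rw [neg_mul, coef q hq]; ring
    rw [h, hc]
    constructor
    · rw [U_rec, V_rec q hq, ih.1]
      simp only [map_smul, qcons_single, smul_smul, ← mul_assoc]
      rfl
    · rw [V_rec q hq, U_rec, ih.2]
      simp only [map_smul, qcons_single, smul_smul, ← mul_assoc]
      rw [mul_comm (1 + q ^ (2 : ℤ))]
      rfl

end QS

theorem stmt14 {F : Type*} [Field F] [CharZero F] (q : F) (hq : q ≠ 0)
    (hq1 : ∀ m : ℕ, 0 < m → q ^ m ≠ 1) (n : ℕ) :
    ∑ k ∈ Finset.range (2 * n + 1),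
        ((-1 : F) ^ k) • qsh q (wpow wYX k ++ [bY]) (wpow wXY (2 * n - k) ++ [bX])
      = ((-1 : F) ^ n * (q + q⁻¹) ^ (2 * n)) •
          (q ^ (-2 : ℤ) • Finsupp.single ([bX] ++ wpow wYYXX n ++ [bY]) (1 : F)
            + Finsupp.single ([bY] ++ wpow wXXYY n ++ [bX]) (1 : F)) := by
  have h := QS.T_eq q (2 * n)
  rw [(QS.UV q hq n).1, (QS.UV q hq n).2, QS.sT,
    Finset.Nat.sum_antidiagonal_eq_sum_range_succ_mk] at h
  simp only [QS.wY, QS.wX]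
  rw [h]
  simp only [map_smul, QS.qcons_single, ← QS.wY, ← QS.wX, List.append_assoc, List.singleton_append]
  rw [smul_add, smul_comm (q ^ (-2 : ℤ)), add_comm]
  rfl
end
end
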